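/- (Biorthogonality of φ_l and ψ_m) Let 1 ≤ l, m ≤ x−1, and define φ_l(n) = τ(n) (1/2πi)∮_D w^{−(x+n−l+1)} ∏_{k=1}^{l} (w − ξ_{k+1}s_{k+1})^{−1} (qv/w;q)_∞ F(w)^{−1} dw and ψ_m(n) = (ξ_{m+1}s_{m+1}/τ(n)) (1/2πi)∮_C z^{n+x−m−1} ∏_{k=2}^{m}(z − ξ_k s_k) F(z) (qv/z;q)_∞^{−1} dz, where D encircles {d, ξ_2 s_2, ..., ξ_x s_x}, C encircles 0 and {vq^k}_{k≥0}, τ(n) = b^n for n ≥ 0 and c^n for n < 0 with v < b < d ≤ inf ξ_k s_k ≤ sup ξ_k s_k < c < inf ξ_k/s_k, and F is a fixed function holomorphic and nonvanishing in the relevant annulus. Then ∑_{n ∈ ℤ} φ_l(n) ψ_m(n) = δ_{l,m}. -/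

import Mathlib

/-- The infinite complex q-Pochhammer symbol `(a;q)_∞ = ∏_{j≥0} (1 - a q^j)`. -/
noncomputable def qPochInfC (q a : ℂ) : ℂ := ∏' j : ℕ, (1 - a * q ^ j)

/-- `τ(n) = b^n` for `n ≥ 0` and `τ(n) = c^n` for `n < 0`. -/
noncomputable def tauFn (b c : ℝ) (n : ℤ) : ℝ := if 0 ≤ n then b ^ n else c ^ n

/-- `φ_l(n) = τ(n) (1/2πi) ∮_D w^{−(x+n−l+1)} ∏_{k=1}^{l} (w − ξ_{k+1}s_{k+1})^{−1}
(qv/w;q)_∞ F(w)^{−1} dw`, with `D` the circle of center `cD` and radius `RD`. -/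
noncomputable def phiFn (q v b c : ℝ) (ξ s : ℕ → ℝ) (F : ℂ → ℂ) (cD : ℂ) (RD : ℝ)
    (x l : ℕ) (n : ℤ) : ℂ :=
  (tauFn b c n : ℂ) * (2 * Real.pi * Complex.I)⁻¹ *
    ∮ w in C(cD, RD),
      w ^ (-((x : ℤ) + n - l + 1)) *
        (∏ k ∈ Finset.Icc 1 l, (w - ((ξ (k + 1) * s (k + 1) : ℝ) : ℂ))⁻¹) *
        qPochInfC (q : ℂ) ((q : ℂ) * (v : ℂ) / w) / F w

/-- `ψ_m(n) = (ξ_{m+1}s_{m+1}/τ(n)) (1/2πi) ∮_C z^{n+x−m−1} ∏_{k=2}^{m} (z − ξ_k s_k)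
F(z) (qv/z;q)_∞^{−1} dz`, with `C` the circle of center `0` and radius `rC`. -/
noncomputable def psiFn (q v b c : ℝ) (ξ s : ℕ → ℝ) (F : ℂ → ℂ) (rC : ℝ)
    (x m : ℕ) (n : ℤ) : ℂ :=
  (((ξ (m + 1) * s (m + 1) : ℝ)) : ℂ) / (tauFn b c n : ℂ) *
    (2 * Real.pi * Complex.I)⁻¹ *
    ∮ z in C(0, rC),
      z ^ (n + (x : ℤ) - m - 1) *
        (∏ k ∈ Finset.Icc 2 m, (z - ((ξ k * s k : ℝ) : ℂ))) *
        F z / qPochInfC (q : ℂ) ((q : ℂ) * (v : ℂ) / z)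


section
open Metric Set Filter Topology

lemma bio_qPoch_differentiable (q : ℝ) (hq0 : 0 ≤ q) (hq1 : q < 1) :
    Differentiable ℂ (qPochInfC (q : ℂ)) := by
  have hloc : ∀ R : ℝ, DifferentiableOn ℂ (qPochInfC (q : ℂ)) (ball (0 : ℂ) R) := by
    intro R
    have hu : Summable (fun n : ℕ => R * q ^ n) :=
      (summable_geometric_of_lt_one hq0 hq1).mul_left R
    have h := Summable.hasProdLocallyUniformlyOn_nat_one_add (K := ball (0 : ℂ) R)
      (f := fun n (a : ℂ) => -(a * (q : ℂ) ^ n)) isOpen_ball hu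
      (.of_forall fun n x hx => by
        have : ‖x‖ < R := by simpa using hx
        simp only [norm_neg, norm_mul, norm_pow, Complex.norm_real, Real.norm_eq_abs,
          abs_of_nonneg hq0]
        gcongr) (fun n => by fun_prop)
    have h2 := h.differentiableOn (.of_forall fun _ ↦ by
      simpa [Finset.prod_fn] using
      DifferentiableOn.finsetProd (fun _ _ ↦ by fun_prop)) isOpen_ball
    exact h2.congr (fun x _ => by simp [qPochInfC, sub_eq_add_neg])
  intro a
  exact (hloc (‖a‖ + 1)).differentiableAt (isOpen_ball.mem_nhds (by simp))

lemma bio_qPoch_ne (q : ℝ) (hq0 : 0 ≤ q) (hq1 : q < 1) (a : ℂ) (ha : ‖a‖ < 1) :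
    qPochInfC (q : ℂ) a ≠ 0 := by
  have : qPochInfC (q : ℂ) a = ∏' j : ℕ, (1 + -(a * (q : ℂ) ^ j)) := by
    simp [qPochInfC, sub_eq_add_neg]
  rw [this]
  have hn : ∀ j : ℕ, ‖-(a * (q : ℂ) ^ j)‖ = ‖a‖ * q ^ j := by
    intro j
    simp [abs_of_nonneg hq0]
  apply tprod_one_add_ne_zero_of_summable
  · intro j hj
    have h1 : -(a * (q : ℂ) ^ j) = -1 := by linear_combination hj
    have h2 := hn j
    rw [h1] at h2
    simp only [norm_neg, norm_one] at h2
    have h3 : q ^ j ≤ 1 := pow_le_one₀ hq0 hq1.le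
    have h4 : 0 ≤ q ^ j := pow_nonneg hq0 j
    nlinarith [norm_nonneg a]
  · simp_rw [hn]
    exact (summable_geometric_of_lt_one hq0 hq1).mul_left _

lemma bio_circle_hasSum {ι : Type*} [Countable ι] (c : ℂ) (R : ℝ) (hR : 0 < R)
    (g : ι → ℂ → ℂ) (G : ℂ → ℂ) (u : ι → ℝ) (hu : Summable u)
    (hg : ∀ i, ContinuousOn (g i) (sphere c R))
    (hb : ∀ i, ∀ z ∈ sphere c R, ‖g i z‖ ≤ u i)
    (hs : ∀ z ∈ sphere c R, HasSum (fun i => g i z) (G z)) :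
    HasSum (fun i => ∮ z in C(c, R), g i z) (∮ z in C(c, R), G z) := by
  unfold circleIntegral
  have hm : ∀ θ, circleMap c R θ ∈ sphere c R := fun θ => circleMap_mem_sphere c hR.le θ
  apply intervalIntegral.hasSum_integral_of_dominated_convergence (fun i _ => R * u i)
  · intro i
    apply Continuous.aestronglyMeasurable
    simp only [deriv_circleMap]
    exact ((continuous_circleMap 0 R).mul continuous_const).smul
      ((hg i).comp_continuous (continuous_circleMap c R) hm)
  · intro i
    refine .of_forall fun θ _ => ?_
    simp only [deriv_circleMap, norm_smul, norm_mul, norm_circleMap_zero, Complex.norm_I, mul_one,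
      abs_of_pos hR]
    exact mul_le_mul_of_nonneg_left (hb i _ (hm θ)) hR.le
  · exact .of_forall fun θ _ => hu.mul_left R
  · exact intervalIntegrable_const
  · exact .of_forall fun θ _ => (hs _ (hm θ)).const_smul _

lemma bio_prod_cont {ι : Type*} (S : Finset ι) (a : ι → ℂ) (T : Set ℂ)
    (h : ∀ i ∈ S, a i ∉ T) : DifferentiableOn ℂ (fun w => ∏ i ∈ S, (w - a i)⁻¹) T := by
  apply DifferentiableOn.fun_finsetProd
  intro i hi
  apply DifferentiableOn.fun_inv (by fun_prop)
  intro w hw h0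
  exact h i hi (by rwa [← sub_eq_zero.1 h0])

lemma bio_Z {ι : Type*} (S : Finset ι) (a : ι → ℂ) (c : ℂ) (R : ℝ) (hR : 0 < R)
    (h : ∀ i ∈ S, a i ∈ ball c R) (hS : 2 ≤ S.card) :
    (∮ w in C(c, R), ∏ i ∈ S, (w - a i)⁻¹) = 0 := by
  have hb : ∀ t : ℝ, 1 ≤ t → ‖∮ w in C(c, R), ∏ i ∈ S, (w - a i)⁻¹‖
      ≤ 2 * Real.pi * (R + t) * (t⁻¹) ^ 2 := by
    intro t ht
    have hd : DifferentiableOn ℂ (fun w => ∏ i ∈ S, (w - a i)⁻¹) ((ball c R)ᶜ) :=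
      bio_prod_cont S a _ (fun i hi => by simpa using h i hi)
    rw [← Complex.circleIntegral_eq_of_differentiable_on_annulus_off_countable
      (R := R + t) hR (by linarith) countable_empty
      (hd.continuousOn.mono (fun z hz => hz.2))
      (fun z hz => hd.differentiableAt
        (mem_of_superset (isClosed_closedBall.isOpen_compl.mem_nhds hz.1.2)
          (compl_subset_compl.2 ball_subset_closedBall)))]
    apply circleIntegral.norm_integral_le_of_norm_le_const (by linarith)
    intro z hz
    have hz' : ‖z - c‖ = R + t := by simpa [dist_eq_norm] using hz
    rw [norm_prod]
    calc ∏ i ∈ S, ‖(z - a i)⁻¹‖ ≤ ∏ i ∈ S, t⁻¹ := by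
          apply Finset.prod_le_prod (fun _ _ => norm_nonneg _)
          intro i hi
          rw [norm_inv]
          have h1 : ‖a i - c‖ < R := by simpa [dist_eq_norm] using h i hi
          have h2 : z - c = (z - a i) + (a i - c) := by ring
          have h3 := norm_add_le (z - a i) (a i - c)
          rw [← h2, hz'] at h3
          exact inv_anti₀ (by linarith) (by linarith)
      _ = (t⁻¹) ^ S.card := by simp
      _ ≤ (t⁻¹) ^ 2 := pow_le_pow_of_le_one (by positivity) (inv_le_one_of_one_le₀ ht) hS
  have hlim : Tendsto (fun t : ℝ => 2 * Real.pi * (R + t) * (t⁻¹) ^ 2) atTop (𝓝 0) := by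
    have e : (fun t : ℝ => 2 * Real.pi * (R * (t⁻¹) ^ 2 + t⁻¹)) =ᶠ[atTop]
        (fun t : ℝ => 2 * Real.pi * (R + t) * (t⁻¹) ^ 2) := by
      filter_upwards [eventually_gt_atTop 0] with t ht
      field_simp
    refine Tendsto.congr' e ?_
    have h1 := tendsto_inv_atTop_zero (𝕜 := ℝ)
    simpa using (((h1.pow 2).const_mul R).add h1).const_mul (2 * Real.pi)
  have := ge_of_tendsto hlim (by filter_upwards [eventually_ge_atTop 1] with t ht using hb t ht)
  exact norm_le_zero_iff.1 this

lemma bio_Zpow {ι : Type*} [DecidableEq ι] (a : ι → ℂ) (c : ℂ) (R : ℝ) (hR : 0 < R) (j : ℕ) :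
    ∀ (S : Finset ι), (∀ i ∈ S, a i ∈ ball c R) → j + 2 ≤ S.card →
    (∮ w in C(c, R), w ^ j * ∏ i ∈ S, (w - a i)⁻¹) = 0 := by
  induction j with
  | zero => intro S h hS; simpa using bio_Z S a c R hR h (by simpa using hS)
  | succ j ih =>
    intro S h hS
    obtain ⟨i, hi⟩ : S.Nonempty := Finset.card_pos.1 (by omega)
    have hns : ∀ k ∈ S, a k ∉ sphere c R := fun k hk hk' => by
      have := h k hk
      simp only [mem_ball, mem_sphere] at this hk'
      linarith
    have hc : ∀ T ⊆ S, CircleIntegrable (fun w => w ^ j * ∏ i ∈ T, (w - a i)⁻¹) c R := by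
      intro T hT
      apply ContinuousOn.circleIntegrable hR.le
      exact (by fun_prop : Continuous fun w : ℂ => w ^ j).continuousOn.mul
        (bio_prod_cont T a _ (fun k hk => hns k (hT hk))).continuousOn
    have e : (∮ w in C(c, R), w ^ (j+1) * ∏ i ∈ S, (w - a i)⁻¹)
        = ∮ w in C(c, R), ((w ^ j * ∏ k ∈ S.erase i, (w - a k)⁻¹)
          + a i • (w ^ j * ∏ i ∈ S, (w - a i)⁻¹)) := by
      apply circleIntegral.integral_congr hR.le
      intro w hw
      have hne : w - a i ≠ 0 := fun h0 => hns i hi (by rwa [← sub_eq_zero.1 h0])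
      simp only [smul_eq_mul]
      rw [← Finset.mul_prod_erase S _ hi]
      field_simp
      ring
    rw [e, circleIntegral.integral_add (hc (S.erase i) (Finset.erase_subset _ _))
      (show CircleIntegrable (fun w => a i • (w ^ j * ∏ i ∈ S, (w - a i)⁻¹)) c R from
        (hc S subset_rfl).const_smul), circleIntegral.integral_smul, ih S h (by omega),
      ih (S.erase i) (fun k hk => h k (Finset.mem_of_mem_erase hk))
        (by rw [Finset.card_erase_of_mem hi]; omega)]
    simp

lemma bio_holo_zero (f : ℂ → ℂ) (c : ℂ) (R : ℝ) (hR : 0 < R)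
    (hf : DifferentiableOn ℂ f (closedBall c R)) : (∮ w in C(c, R), f w) = 0 :=
  Complex.circleIntegral_eq_zero_of_differentiable_on_off_countable hR.le countable_empty
    hf.continuousOn (fun z hz => hf.differentiableAt
      (mem_of_superset (isOpen_ball.mem_nhds hz.1) ball_subset_closedBall))

lemma bio_indep {ι : Type*} [DecidableEq ι] (a : ι → ℂ) (c₁ c₂ : ℂ) (R₁ R₂ : ℝ) (hR₁ : 0 < R₁)
    (hR₂ : 0 < R₂) (S : Finset ι) : ∀ (f : ℂ → ℂ),
    (∀ i ∈ S, a i ∈ ball c₁ R₁) → (∀ i ∈ S, a i ∈ ball c₂ R₂) →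
    DifferentiableOn ℂ f (closedBall c₁ R₁ ∪ closedBall c₂ R₂) →
    (∮ w in C(c₁, R₁), f w * ∏ i ∈ S, (w - a i)⁻¹)
      = ∮ w in C(c₂, R₂), f w * ∏ i ∈ S, (w - a i)⁻¹ := by
  induction S using Finset.induction_on with
  | empty =>
    intro f _ _ hf
    simp only [Finset.prod_empty, mul_one]
    rw [bio_holo_zero f c₁ R₁ hR₁ (hf.mono subset_union_left),
      bio_holo_zero f c₂ R₂ hR₂ (hf.mono subset_union_right)]
  | insert i S hi ih =>
    intro f h₁ h₂ hf
    have hnh : closedBall c₁ R₁ ∪ closedBall c₂ R₂ ∈ 𝓝 (a i) :=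
      mem_of_superset (isOpen_ball.mem_nhds (h₁ i (Finset.mem_insert_self _ _)))
        (ball_subset_closedBall.trans subset_union_left)
    have hds := (Complex.differentiableOn_dslope hnh).2 hf
    have key : ∀ (c : ℂ) (R : ℝ), 0 < R → (∀ k ∈ insert i S, a k ∈ ball c R) →
        closedBall c R ⊆ closedBall c₁ R₁ ∪ closedBall c₂ R₂ →
        (∮ w in C(c, R), f w * ∏ k ∈ insert i S, (w - a k)⁻¹)
        = (∮ w in C(c, R), dslope f (a i) w * ∏ k ∈ S, (w - a k)⁻¹)
          + f (a i) * ∮ w in C(c, R), ∏ k ∈ insert i S, (w - a k)⁻¹ := by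
      intro c R hR h hsub
      have hns : ∀ k ∈ insert i S, a k ∉ sphere c R := fun k hk hk' => by
        have := h k hk
        simp only [mem_ball, mem_sphere] at this hk'
        linarith
      rw [← smul_eq_mul (f (a i)), ← circleIntegral.integral_smul, ← circleIntegral.integral_add]
      · apply circleIntegral.integral_congr hR.le
        intro w hw
        have hne : w - a i ≠ 0 := fun h0 =>
          hns i (Finset.mem_insert_self _ _) (by rwa [← sub_eq_zero.1 h0])
        have hne' : w ≠ a i := sub_ne_zero.1 hne
        simp only [smul_eq_mul]
        rw [Finset.prod_insert hi, dslope_of_ne _ hne', slope_def_field]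
        field_simp
        ring
      · apply ContinuousOn.circleIntegrable hR.le
        exact (hds.continuousOn.mono (sphere_subset_closedBall.trans hsub)).mul
          (bio_prod_cont S a _ (fun k hk => hns k (Finset.mem_insert_of_mem hk))).continuousOn
      · apply CircleIntegrable.const_smul
        apply ContinuousOn.circleIntegrable hR.le
        exact (bio_prod_cont _ a _ hns).continuousOn
    have one : ∀ (c : ℂ) (R : ℝ), 0 < R → (∀ k ∈ insert i S, a k ∈ ball c R) →
        (∮ w in C(c, R), ∏ k ∈ insert i S, (w - a k)⁻¹)
        = if S = ∅ then 2 * Real.pi * Complex.I else 0 := by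
      intro c R hR h
      split_ifs with hS
      · subst hS
        simpa using circleIntegral.integral_sub_inv_of_mem_ball (h i (by simp))
      · apply bio_Z _ a c R hR h
        rw [Finset.card_insert_of_notMem hi]
        have := Finset.card_pos.2 (Finset.nonempty_iff_ne_empty.2 hS)
        omega
    rw [key c₁ R₁ hR₁ h₁ subset_union_left, key c₂ R₂ hR₂ h₂ subset_union_right,
      one c₁ R₁ hR₁ h₁, one c₂ R₂ hR₂ h₂,
      ih _ (fun k hk => h₁ k (Finset.mem_insert_of_mem hk))
        (fun k hk => h₂ k (Finset.mem_insert_of_mem hk)) hds]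

lemma bio_int_cases (n : ℤ) : (∃ k : ℕ, n = k) ∨ ∃ k : ℕ, n = -((k : ℤ) + 1) := by
  rcases le_or_gt 0 n with h | h
  · exact Or.inl ⟨n.toNat, by omega⟩
  · exact Or.inr ⟨(-n - 1).toNat, by omega⟩

lemma bio_glue (u₁ u₂ : ℕ → ℝ) (h₁ : Summable u₁) (h₂ : Summable u₂) :
    ∃ u : ℤ → ℝ, Summable u ∧ (∀ k : ℕ, u k = u₁ k) ∧ ∀ k : ℕ, u (-((k : ℤ) + 1)) = u₂ k := by
  have e1 : ∀ k : ℕ, (fun n : ℤ => if 0 ≤ n then u₁ n.toNat else u₂ (-n - 1).toNat) k = u₁ k := by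
    intro k; simp
  have e2 : ∀ k : ℕ, (fun n : ℤ => if 0 ≤ n then u₁ n.toNat else u₂ (-n - 1).toNat)
      (-((k : ℤ) + 1)) = u₂ k := by
    intro k
    have : ¬ (0 : ℤ) ≤ -((k : ℤ) + 1) := by omega
    simp only [this, if_false]
    congr 1
    omega
  refine ⟨(fun n : ℤ => if 0 ≤ n then u₁ n.toNat else u₂ (-n - 1).toNat), ?_, e1, e2⟩
  apply Summable.of_nat_of_neg_add_one
  · exact h₁.congr (fun k => (e1 k).symm)
  · exact h₂.congr (fun k => (e2 k).symm)

lemma bio_shift (P : ℂ → ℂ) (r R : ℝ) (hr : 0 < r) (hrR : r ≤ R)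
    (hP : DifferentiableOn ℂ P {z | r ≤ ‖z‖ ∧ ‖z‖ ≤ R}) :
    (∮ z in C(0, R), P z) = ∮ z in C(0, r), P z := by
  refine Complex.circleIntegral_eq_of_differentiable_on_annulus_off_countable
      hr hrR countable_empty
      (hP.continuousOn.mono (fun z hz => ?_))
      (fun z hz => hP.differentiableAt ?_)
  · simp at hz; exact ⟨hz.2, hz.1⟩
  · have : IsOpen {z : ℂ | r < ‖z‖ ∧ ‖z‖ < R} :=
      (isOpen_lt continuous_const continuous_norm).inter (isOpen_lt continuous_norm continuous_const)
    refine mem_of_superset (this.mem_nhds (x := z) ?_) (fun y hy => ⟨hy.1.le, hy.2.le⟩)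
    simp at hz; exact ⟨hz.2, hz.1⟩

lemma bio_cauchy (P : ℂ → ℂ) (r R : ℝ) (hr : 0 < r)
    (hP : DifferentiableOn ℂ P {z | r ≤ ‖z‖ ∧ ‖z‖ ≤ R}) (w : ℂ) (hw1 : r < ‖w‖) (hw2 : ‖w‖ < R) :
    (∮ z in C(0, r), P z * (w - z)⁻¹) + (∮ z in C(0, R), P z * (z - w)⁻¹)
      = 2 * Real.pi * Complex.I * P w := by
  have hO : IsOpen {z : ℂ | r < ‖z‖ ∧ ‖z‖ < R} :=
      (isOpen_lt continuous_const continuous_norm).inter (isOpen_lt continuous_norm continuous_const)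
  have hnh : {z : ℂ | r ≤ ‖z‖ ∧ ‖z‖ ≤ R} ∈ 𝓝 w :=
    mem_of_superset (hO.mem_nhds (x := w) ⟨hw1, hw2⟩) (fun y hy => ⟨hy.1.le, hy.2.le⟩)
  have hds := (Complex.differentiableOn_dslope hnh).2 hP
  have h := bio_shift _ r R hr (hw1.trans hw2).le hds
  have key : ∀ ρ : ℝ, 0 < ρ → r ≤ ρ → ρ ≤ R → ρ ≠ ‖w‖ →
      (∮ z in C(0, ρ), dslope P w z) = (∮ z in C(0, ρ), P z * (z - w)⁻¹)
        - P w * ∮ z in C(0, ρ), (z - w)⁻¹ := by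
    intro ρ h0 h1 h2 h3
    have hne : ∀ z ∈ sphere (0 : ℂ) ρ, z - w ≠ 0 := by
      intro z hz h
      rw [sub_eq_zero.1 h] at hz
      simp at hz
      exact h3 hz.symm
    have hc : ContinuousOn (fun z : ℂ => (z - w)⁻¹) (sphere 0 ρ) :=
      ContinuousOn.inv₀ (by fun_prop) hne
    have hPc : ContinuousOn P (sphere 0 ρ) := hP.continuousOn.mono (fun z hz => by
      simp at hz; exact ⟨by linarith, by linarith⟩)
    rw [← smul_eq_mul (P w), ← circleIntegral.integral_smul, ← circleIntegral.integral_sub]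
    · apply circleIntegral.integral_congr h0.le
      intro z hz
      have := hne z hz
      simp only [smul_eq_mul]
      rw [dslope_of_ne _ (sub_ne_zero.1 this), slope_def_field]
      field_simp
    · exact (hPc.mul hc).circleIntegrable h0.le
    · exact CircleIntegrable.const_smul (hc.circleIntegrable h0.le)
  rw [key R (by linarith) (by linarith) le_rfl hw2.ne', key r hr le_rfl (by linarith) hw1.ne,
    circleIntegral.integral_sub_inv_of_mem_ball (by simpa using hw2)] at h
  have hz : (∮ z in C(0, r), (z - w)⁻¹) = 0 := by
    apply bio_holo_zero _ _ _ hr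
    apply DifferentiableOn.fun_inv (by fun_prop)
    intro z hz h0
    rw [sub_eq_zero.1 h0] at hz
    simp at hz
    linarith
  rw [hz] at h
  have hneg : (∮ z in C(0, r), P z * (w - z)⁻¹) = - ∮ z in C(0, r), P z * (z - w)⁻¹ := by
    rw [← neg_one_mul, ← circleIntegral.integral_const_mul]
    apply circleIntegral.integral_congr hr.le
    intro z hz
    simp only
    rw [← neg_sub z w, inv_neg]
    ring
  rw [hneg]
  linear_combination h

lemma bio_zpow_shift (P : ℂ → ℂ) (r R : ℝ) (hr : 0 < r) (hrR : r ≤ R)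
    (hP : DifferentiableOn ℂ P {z | r ≤ ‖z‖ ∧ ‖z‖ ≤ R}) (n : ℤ) :
    (∮ z in C(0, R), z ^ n * P z) = ∮ z in C(0, r), z ^ n * P z := by
  apply bio_shift _ r R hr hrR
  refine DifferentiableOn.fun_mul (fun z hz => ?_) hP
  have : z ≠ 0 := norm_pos_iff.1 (hr.trans_le hz.1)
  exact (differentiableAt_zpow.2 (Or.inl this)).differentiableWithinAt

lemma bio_laurent (P : ℂ → ℂ) (r R : ℝ) (hr : 0 < r)
    (hP : DifferentiableOn ℂ P {z | r ≤ ‖z‖ ∧ ‖z‖ ≤ R}) (w : ℂ) (hw1 : r < ‖w‖) (hw2 : ‖w‖ < R) :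
    HasSum (fun n : ℤ => (∮ z in C(0, r), z ^ n * P z) * w ^ (-n - 1))
      (2 * Real.pi * Complex.I * P w) := by
  have hw0 : 0 < ‖w‖ := hr.trans hw1
  have hwne : w ≠ 0 := norm_pos_iff.1 hw0
  have hR : 0 < R := hw0.trans hw2
  have hPc : ∀ ρ, r ≤ ρ → ρ ≤ R → ContinuousOn P (sphere 0 ρ) := fun ρ h1 h2 =>
    hP.continuousOn.mono (fun z hz => by simp at hz; exact ⟨by linarith, by linarith⟩)
  rw [← bio_cauchy P r R hr hP w hw1 hw2]
  apply HasSum.of_nat_of_neg_add_one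
  · obtain ⟨M, hM⟩ := (isCompact_sphere (0 : ℂ) r).exists_bound_of_continuousOn
      (hPc r le_rfl (by linarith))
    have := bio_circle_hasSum 0 r hr (fun (n : ℕ) z => w ^ (-(n : ℤ) - 1) * (z ^ (n : ℤ) * P z))
      (fun z => P z * (w - z)⁻¹) (fun n => ‖w‖⁻¹ * M * (r / ‖w‖) ^ n)
      ((summable_geometric_of_lt_one (by positivity) ((div_lt_one hw0).2 hw1)).mul_left _)
      (fun n => by
        simp only [zpow_natCast]
        exact continuousOn_const.mul ((continuousOn_id.pow n).mul (hPc r le_rfl (by linarith))))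
      (fun n z hz => by
        have h1 := hM z hz
        have h2 : ‖z‖ = r := by simpa using hz
        simp only [norm_mul, norm_zpow, h2]
        rw [zpow_natCast, zpow_sub₀ hw0.ne', zpow_neg, zpow_natCast, zpow_one, div_pow]
        calc (‖w‖ ^ n)⁻¹ / ‖w‖ * (r ^ n * ‖P z‖) ≤ (‖w‖ ^ n)⁻¹ / ‖w‖ * (r ^ n * M) := by gcongr
          _ = _ := by field_simp)
      (fun z hz => by
        have h2 : ‖z‖ = r := by simpa using hz
        have hg := hasSum_geometric_of_norm_lt_one (ξ := z / w)
          (by rw [norm_div, h2]; exact (div_lt_one hw0).2 hw1)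
        have hne : w - z ≠ 0 := fun h => by rw [sub_eq_zero.1 h] at hw1; linarith
        have hne' : 1 - z / w ≠ 0 := by
          have : 1 - z / w = (w - z) / w := by field_simp
          rw [this]; exact div_ne_zero hne hwne
        have hh := hg.mul_left (w⁻¹ * P z)
        have e2 : w⁻¹ * P z * (1 - z / w)⁻¹ = P z * (w - z)⁻¹ := by
          have : 1 - z / w = (w - z) / w := by field_simp
          rw [this]; field_simp
        rw [e2] at hh
        refine Eq.subst (motive := fun f => HasSum f _) (funext fun n => ?_) hh
        rw [zpow_sub₀ hwne, zpow_neg, zpow_natCast, zpow_natCast, zpow_one, div_pow]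
        field_simp)
    convert this using 1
    funext n
    rw [circleIntegral.integral_const_mul, mul_comm]
  · obtain ⟨M, hM⟩ := (isCompact_sphere (0 : ℂ) R).exists_bound_of_continuousOn
      (hPc R (by linarith) le_rfl)
    have := bio_circle_hasSum 0 R hR (fun (n : ℕ) z => w ^ n * ((z ^ (n + 1))⁻¹ * P z))
      (fun z => P z * (z - w)⁻¹) (fun n => R⁻¹ * M * (‖w‖ / R) ^ n)
      ((summable_geometric_of_lt_one (by positivity) ((div_lt_one hR).2 hw2)).mul_left _)
      (fun n => by
        refine continuousOn_const.mul ((ContinuousOn.inv₀ (continuousOn_id.pow (n + 1)) ?_).mul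
          (hPc R (by linarith) le_rfl))
        intro z hz h
        have h2 : ‖z‖ = R := by simpa using hz
        have : z = 0 := by simpa using h
        rw [this] at h2; simp at h2; linarith)
      (fun n z hz => by
        have h1 := hM z hz
        have h2 : ‖z‖ = R := by simpa using hz
        simp only [norm_mul, norm_pow, norm_inv, h2]
        calc ‖w‖ ^ n * ((R ^ (n+1))⁻¹ * ‖P z‖) ≤ ‖w‖ ^ n * ((R ^ (n+1))⁻¹ * M) := by gcongr
          _ = _ := by rw [div_pow]; field_simp; ring)
      (fun z hz => by
        have h2 : ‖z‖ = R := by simpa using hz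
        have hz0 : z ≠ 0 := norm_pos_iff.1 (by linarith)
        have hg := hasSum_geometric_of_norm_lt_one (ξ := w / z)
          (by rw [norm_div, h2]; exact (div_lt_one hR).2 hw2)
        have hne : z - w ≠ 0 := fun h => by rw [← sub_eq_zero.1 h] at hw2; linarith
        have hh := hg.mul_left (z⁻¹ * P z)
        have e2 : z⁻¹ * P z * (1 - w / z)⁻¹ = P z * (z - w)⁻¹ := by
          have : 1 - w / z = (z - w) / z := by field_simp
          rw [this]; field_simp
        rw [e2] at hh
        refine Eq.subst (motive := fun f => HasSum f _) (funext fun n => ?_) hh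
        rw [div_pow]
        field_simp
        ring)
    convert this using 1
    funext n
    rw [circleIntegral.integral_const_mul, mul_comm, ← bio_zpow_shift P r R hr (by linarith) hP]
    congr 1
    rw [← zpow_natCast]; congr 1; ring

lemma bio_coeff_bound (P : ℂ → ℂ) (r R : ℝ) (hr : 0 < r) (hrR : r ≤ R)
    (hP : DifferentiableOn ℂ P {z | r ≤ ‖z‖ ∧ ‖z‖ ≤ R}) :
    ∃ M : ℝ, 0 ≤ M ∧ ∀ n : ℤ, ‖∮ z in C(0, r), z ^ n * P z‖ ≤ M * r ^ n ∧
      ‖∮ z in C(0, r), z ^ n * P z‖ ≤ M * R ^ n := by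
  have key : ∀ ρ, r ≤ ρ → ρ ≤ R → ∃ M : ℝ, 0 ≤ M ∧
      ∀ n : ℤ, ‖∮ z in C(0, r), z ^ n * P z‖ ≤ M * ρ ^ n := by
    intro ρ h1 h2
    have hρ : 0 < ρ := by linarith
    obtain ⟨M, hM⟩ := (isCompact_sphere (0 : ℂ) ρ).exists_bound_of_continuousOn
      (hP.continuousOn.mono (fun z hz => by
        simp at hz; exact ⟨by linarith, by linarith⟩ : sphere (0 : ℂ) ρ ⊆ _))
    have hM0 : 0 ≤ M := (norm_nonneg _).trans (hM (ρ : ℂ) (by simp [abs_of_pos hρ]))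
    refine ⟨2 * Real.pi * ρ * M, by positivity, fun n => ?_⟩
    rw [← bio_zpow_shift P r ρ hr h1 (hP.mono (fun z hz => ⟨hz.1, hz.2.trans h2⟩))]
    have := circleIntegral.norm_integral_le_of_norm_le_const (f := fun z => z ^ n * P z) (c := 0)
      (R := ρ) (C := ρ ^ n * M) hρ.le (fun z hz => by
        have h3 : ‖z‖ = ρ := by simpa using hz
        rw [norm_mul, norm_zpow, h3]
        have := hM z hz
        gcongr)
    linarith
  obtain ⟨M1, h1, h1'⟩ := key r le_rfl hrR
  obtain ⟨M2, h2, h2'⟩ := key R hrR le_rfl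
  have hR : 0 < R := by linarith
  refine ⟨max M1 M2, le_max_of_le_left h1, fun n => ⟨(h1' n).trans ?_, (h2' n).trans ?_⟩⟩
  · gcongr; exact le_max_left _ _
  · gcongr; exact le_max_right _ _

lemma bio_sum (P H : ℂ → ℂ) (r R : ℝ) (hr : 0 < r)
    (hP : DifferentiableOn ℂ P {z | r ≤ ‖z‖ ∧ ‖z‖ ≤ R}) (c₀ : ℂ) (R₀ : ℝ) (hR₀ : 0 < R₀)
    (ρ₁ ρ₂ : ℝ) (hρ₁ : r < ρ₁) (hρ₂ : ρ₂ < R) (hρ : ρ₁ ≤ ρ₂)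
    (hsub : ∀ w ∈ sphere c₀ R₀, ρ₁ ≤ ‖w‖ ∧ ‖w‖ ≤ ρ₂) (hH : ContinuousOn H (sphere c₀ R₀)) :
    HasSum (fun n : ℤ => (∮ w in C(c₀, R₀), w ^ (-n - 1) * H w) * ∮ z in C(0, r), z ^ n * P z)
      (∮ w in C(c₀, R₀), 2 * Real.pi * Complex.I * P w * H w) := by
  obtain ⟨M, hM0, hM⟩ := bio_coeff_bound P r R hr (by linarith) hP
  obtain ⟨N, hN⟩ := (isCompact_sphere c₀ R₀).exists_bound_of_continuousOn hH
  have hρ1 : 0 < ρ₁ := by linarith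
  have hρ2 : 0 < ρ₂ := by linarith
  have hR : 0 < R := by linarith
  obtain ⟨u, hu, hu1, hu2⟩ := bio_glue (fun k => ρ₁⁻¹ * M * N * (r / ρ₁) ^ k)
    (fun k => R⁻¹ * M * N * (ρ₂ / R) ^ k)
    ((summable_geometric_of_lt_one (by positivity) ((div_lt_one hρ1).2 hρ₁)).mul_left _)
    ((summable_geometric_of_lt_one (by positivity) ((div_lt_one hR).2 hρ₂)).mul_left _)
  have := bio_circle_hasSum c₀ R₀ hR₀
    (fun (n : ℤ) w => (∮ z in C(0, r), z ^ n * P z) * (w ^ (-n - 1) * H w))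
    (fun w => 2 * Real.pi * Complex.I * P w * H w) u hu
    (fun n => by
      refine continuousOn_const.mul (ContinuousOn.mul (fun z hz => ?_) hH)
      have : z ≠ 0 := norm_pos_iff.1 (hρ1.trans_le (hsub z hz).1)
      exact (continuousAt_zpow₀ _ _ (Or.inl this)).continuousWithinAt)
    (fun n w hw => by
      have hn := hN w hw
      have hN0 : 0 ≤ N := (norm_nonneg _).trans hn
      obtain ⟨hs1, hs2⟩ := hsub w hw
      have hw0 : 0 < ‖w‖ := by linarith
      rcases bio_int_cases n with ⟨k, rfl⟩ | ⟨k, rfl⟩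
      · rw [hu1, norm_mul, norm_mul, norm_zpow]
        have h1 := (hM k).1
        rw [zpow_natCast] at h1
        have h2 : ‖w‖ ^ (-(k : ℤ) - 1) ≤ (ρ₁ ^ (k + 1))⁻¹ := by
          have : (-(k : ℤ) - 1) = -((k + 1 : ℕ) : ℤ) := by push_cast; ring
          rw [this, zpow_neg, zpow_natCast]
          gcongr
        calc _ ≤ (M * r ^ k) * ((ρ₁ ^ (k + 1))⁻¹ * N) := by gcongr
          _ = _ := by rw [div_pow]; field_simp; ring
      · rw [hu2, norm_mul, norm_mul, norm_zpow]
        have h1 := (hM (-((k : ℤ) + 1))).2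
        have e1 : R ^ (-((k : ℤ) + 1)) = (R ^ (k + 1))⁻¹ := by rw [zpow_neg]; norm_cast
        rw [e1] at h1
        have h2 : ‖w‖ ^ (-(-((k : ℤ) + 1)) - 1) ≤ ρ₂ ^ k := by
          have : (-(-((k : ℤ) + 1)) - 1) = k := by ring
          rw [this, zpow_natCast]
          gcongr
        calc _ ≤ (M * (R ^ (k + 1))⁻¹) * (ρ₂ ^ k * N) := by gcongr
          _ = _ := by rw [div_pow]; field_simp; ring)
    (fun w hw => by
      obtain ⟨hs1, hs2⟩ := hsub w hw
      have := (bio_laurent P r R hr hP w (by linarith) (by linarith)).mul_right (H w)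
      simpa only [mul_assoc] using this)
  convert this using 1
  funext n
  rw [circleIntegral.integral_const_mul, mul_comm]

lemma bio_final (a : ℕ → ℂ) (l m : ℕ) (hl1 : 1 ≤ l) (hm1 : 1 ≤ m) (c : ℂ) (R : ℝ) (hR : 0 < R)
    (h0 : ∀ w ∈ closedBall c R, w ≠ 0) (hal : ∀ k ∈ Finset.Icc 2 (l + 1), a k ∈ ball c R)
    (ham : a (m + 1) ≠ 0) :
    a (m + 1) * ((2 * Real.pi * Complex.I)⁻¹ *
      ∮ w in C(c, R), w ^ ((l : ℤ) - m - 1) * (∏ k ∈ Finset.Icc 2 m, (w - a k)) *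
        ∏ k ∈ Finset.Icc 1 l, (w - a (k + 1))⁻¹) = if l = m then 1 else 0 := by
  have hns : ∀ w ∈ sphere c R, ∀ k ∈ Finset.Ico 1 (l + 1), w - a (k + 1) ≠ 0 := by
    intro w hw k hk h
    have h1 := hal (k + 1) (by simp at hk ⊢; omega)
    rw [← sub_eq_zero.1 h] at h1
    simp only [mem_ball, mem_sphere] at h1 hw
    linarith
  have e1 : ∀ w : ℂ, ∏ k ∈ Finset.Icc 2 m, (w - a k) = ∏ k ∈ Finset.Ico 1 m, (w - a (k + 1)) := by
    intro w
    rw [Finset.prod_Ico_add' (fun k => w - a k) 1 m 1]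
    rfl
  have e2 : Finset.Icc 1 l = Finset.Ico 1 (l + 1) := rfl
  rw [e2]
  simp only [e1]
  rcases lt_or_ge l m with hlm | hlm
  · rw [if_neg (by omega)]
    have : (∮ w in C(c, R), w ^ ((l : ℤ) - m - 1) * (∏ k ∈ Finset.Ico 1 m, (w - a (k + 1))) *
        ∏ k ∈ Finset.Ico 1 (l + 1), (w - a (k + 1))⁻¹)
        = ∮ w in C(c, R), w ^ ((l : ℤ) - m - 1) * (∏ k ∈ Finset.Ico (l + 1) m, (w - a (k + 1))) := by
      apply circleIntegral.integral_congr hR.le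
      intro w hw
      have hp : ∏ k ∈ Finset.Ico 1 (l + 1), (w - a (k + 1)) ≠ 0 :=
        Finset.prod_ne_zero_iff.2 (hns w hw)
      simp only
      rw [← Finset.prod_Ico_consecutive (fun k => w - a (k + 1)) (show 1 ≤ l + 1 by omega)
        (show l + 1 ≤ m by omega), Finset.prod_inv_distrib]
      field_simp
    rw [this, bio_holo_zero _ _ _ hR, mul_zero, mul_zero]
    refine DifferentiableOn.fun_mul (fun w hw => ?_) ?_
    · exact (differentiableAt_zpow.2 (Or.inl (h0 w hw))).differentiableWithinAt
    · exact DifferentiableOn.fun_finsetProd (fun k _ => by fun_prop)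
  · have : (∮ w in C(c, R), w ^ ((l : ℤ) - m - 1) * (∏ k ∈ Finset.Ico 1 m, (w - a (k + 1))) *
        ∏ k ∈ Finset.Ico 1 (l + 1), (w - a (k + 1))⁻¹)
        = ∮ w in C(c, R), w ^ ((l : ℤ) - m - 1) *
          (∏ k ∈ Finset.Ico m (l + 1), (w - a (k + 1))⁻¹) := by
      apply circleIntegral.integral_congr hR.le
      intro w hw
      have hp : ∏ k ∈ Finset.Ico 1 m, (w - a (k + 1)) ≠ 0 :=
        Finset.prod_ne_zero_iff.2 (fun k hk => hns w hw k (by simp at hk ⊢; omega))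
      simp only
      rw [← Finset.prod_Ico_consecutive (fun k => (w - a (k + 1))⁻¹) (show 1 ≤ m by omega)
        (show m ≤ l + 1 by omega), Finset.prod_inv_distrib (s := Finset.Ico 1 m)]
      field_simp
    rw [this]
    rcases hlm.eq_or_lt with rfl | hlt
    · rw [if_pos rfl]
      have hd : DifferentiableOn ℂ (fun w : ℂ => w⁻¹) (closedBall c R) :=
        DifferentiableOn.fun_inv (by fun_prop) h0
      have hc := hd.circleIntegral_sub_inv_smul (hal (m + 1) (by simp; omega))
      have e3 : (∮ w in C(c, R), w ^ ((m : ℤ) - m - 1) *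
          (∏ k ∈ Finset.Ico m (m + 1), (w - a (k + 1))⁻¹))
          = ∮ w in C(c, R), (w - a (m + 1))⁻¹ • w⁻¹ := by
        congr 1
        funext w
        simp [mul_comm]
      rw [e3, hc]
      simp only [smul_eq_mul]
      have hpi : (2 * Real.pi * Complex.I : ℂ) ≠ 0 := Complex.two_pi_I_ne_zero
      field_simp
    · rw [if_neg (by omega)]
      have hz := bio_Zpow (fun k => a (k + 1)) c R hR (l - m - 1) (Finset.Ico m (l + 1))
        (fun k hk => hal (k + 1) (by simp at hk ⊢; omega)) (by simp; omega)
      have e4 : (l : ℤ) - m - 1 = ((l - m - 1 : ℕ) : ℤ) := by omega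
      simp only [e4, zpow_natCast]
      rw [hz]
      simp

end

/-- Biorthogonality `∑_{n ∈ ℤ} φ_l(n) ψ_m(n) = δ_{l,m}` for `1 ≤ l, m ≤ x−1`, where the
contour `D = C(cD, RD)` encircles `{d, ξ₂s₂, …, ξₓsₓ}` and not `0`, the contour
`C = C(0, rC)` encircles `0` and `{vq^k}_{k ≥ 0}`, the parameters satisfy
`q·ξₖsₖ < d`, `v < b < d ≤ ξₖsₖ < c < ξₖ/sₖ`, and `F` is holomorphic and nonvanishing
in an annulus containing both contours. -/
theorem biorthogonality_phi_psi
    (q v d b c : ℝ) (x l m : ℕ) (ξ s : ℕ → ℝ) (F : ℂ → ℂ)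
    (hq0 : 0 ≤ q) (hq1 : q < 1) (hv0 : 0 < v)
    (hx : 2 ≤ x) (hl1 : 1 ≤ l) (hl : l ≤ x - 1) (hm1 : 1 ≤ m) (hm : m ≤ x - 1)
    (hvb : v < b) (hbd : b < d)
    (hqd : ∀ k ∈ Finset.Icc 2 x, q * (ξ k * s k) < d)
    (hds : ∀ k ∈ Finset.Icc 2 x, d ≤ ξ k * s k)
    (hsc : ∀ k ∈ Finset.Icc 2 x, ξ k * s k < c)
    (hcξs : ∀ k ∈ Finset.Icc 2 x, c < ξ k / s k)
    -- the contour `D` : circle of center `cD`, radius `RD`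
    (cD : ℂ) (RD : ℝ) (hRD : 0 < RD) (hD0 : RD < ‖cD‖)
    (hDin : ∀ k ∈ Finset.Icc 2 x, ‖((ξ k * s k : ℝ) : ℂ) - cD‖ < RD)
    (hDd : ‖((d : ℝ) : ℂ) - cD‖ < RD)
    (hDc : ∀ z ∈ Metric.closedBall cD RD, ‖z‖ < c)
    -- the contour `C` : circle of center `0`, radius `rC`
    (rC : ℝ) (hrC : 0 < rC) (hCv : v < rC) (hCb : rC < b)
    -- `F` holomorphic and nonvanishing in an annulus containing both contours
    (rin rout : ℝ) (hrin : 0 < rin) (hrinC : rin < rC) (hCann : rC ≤ rout)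
    (hFdiff : DifferentiableOn ℂ F {z : ℂ | rin ≤ ‖z‖ ∧ ‖z‖ ≤ rout})
    (hFne : ∀ z : ℂ, rin ≤ ‖z‖ → ‖z‖ ≤ rout → F z ≠ 0)
    (hDann : Metric.closedBall cD RD ⊆ {z : ℂ | rin ≤ ‖z‖ ∧ ‖z‖ ≤ rout}) :
    Summable (fun n : ℤ =>
      phiFn q v b c ξ s F cD RD x l n * psiFn q v b c ξ s F rC x m n)
    ∧ ∑' n : ℤ, phiFn q v b c ξ s F cD RD x l n * psiFn q v b c ξ s F rC x m n
        = if l = m then 1 else 0 := by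
  classical
  have hmem : ∀ k : ℕ, 2 ≤ k → k ≤ x → k ∈ Finset.Icc 2 x := fun k h1 h2 => by simp; omega
  have hb0 : 0 < b := hv0.trans hvb
  have hd0 : 0 < d := hb0.trans hbd
  have hc0 : 0 < c := (hd0.trans_le (hds 2 (hmem 2 le_rfl hx))).trans (hsc 2 (hmem 2 le_rfl hx))
  -- an upper bound for the poles
  obtain ⟨A, hA1, hA2, hAd⟩ : ∃ A : ℝ, (∀ k ∈ Finset.Icc 2 x, ξ k * s k < A) ∧ A < rout ∧ d < A := by
    obtain ⟨k₀, hk₀, hmax⟩ := Finset.exists_max_image (Finset.Icc 2 x) (fun k => ξ k * s k)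
      ⟨2, hmem 2 le_rfl hx⟩
    have hlt : ξ k₀ * s k₀ < rout := by
      have hin := hDin k₀ hk₀
      set ε := RD - ‖((ξ k₀ * s k₀ : ℝ) : ℂ) - cD‖ with hε
      have hεpos : 0 < ε := by linarith
      have hmm : (((ξ k₀ * s k₀ + ε : ℝ)) : ℂ) ∈ Metric.closedBall cD RD := by
        rw [mem_closedBall_iff_norm]
        have e : (((ξ k₀ * s k₀ + ε : ℝ)) : ℂ) - cD
            = (((ξ k₀ * s k₀ : ℝ) : ℂ) - cD) + ((ε : ℝ) : ℂ) := by push_cast; ring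
        rw [e]
        refine (norm_add_le _ _).trans ?_
        rw [Complex.norm_real, Real.norm_eq_abs, abs_of_pos hεpos]
        linarith
      have h2 := (hDann hmm).2
      rw [Complex.norm_real, Real.norm_eq_abs] at h2
      have h3 := le_abs_self (ξ k₀ * s k₀ + ε)
      linarith
    have hd' := hds k₀ hk₀
    refine ⟨(ξ k₀ * s k₀ + rout) / 2, fun k hk => ?_, by linarith, by linarith⟩
    have := hmax k hk
    linarith
  -- the auxiliary contour
  set c₀ : ℂ := (((b + A) / 2 : ℝ) : ℂ) with hc₀
  set R₀ : ℝ := (A - b) / 2 with hR₀def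
  have hR₀ : 0 < R₀ := by rw [hR₀def]; linarith
  have hball : ∀ w ∈ Metric.closedBall c₀ R₀, b ≤ ‖w‖ ∧ ‖w‖ ≤ A := by
    intro w hw
    rw [mem_closedBall_iff_norm] at hw
    have hn : ‖c₀‖ = (b + A) / 2 := by
      rw [hc₀, Complex.norm_real, Real.norm_eq_abs, abs_of_pos (by linarith)]
    have h1 := norm_add_le (w - c₀) c₀
    have h2 := norm_sub_norm_le c₀ (c₀ - w)
    rw [sub_sub_cancel, norm_sub_rev] at h2
    rw [sub_add_cancel] at h1
    constructor <;> linarith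
  have hpole : ∀ k ∈ Finset.Icc 2 x, ((ξ k * s k : ℝ) : ℂ) ∈ Metric.ball c₀ R₀ := by
    intro k hk
    rw [mem_ball_iff_norm, hc₀, ← Complex.ofReal_sub, Complex.norm_real, Real.norm_eq_abs, abs_lt]
    have h1 := hA1 k hk
    have h2 := hds k hk
    constructor <;> linarith
  have hpole' : ∀ k ∈ Finset.Icc 2 x, ((ξ k * s k : ℝ) : ℂ) ∈ Metric.ball cD RD := by
    intro k hk
    rw [mem_ball_iff_norm]
    exact hDin k hk
  set Ann : Set ℂ := {z : ℂ | rin ≤ ‖z‖ ∧ ‖z‖ ≤ rout} with hAnn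
  have hAnn0 : ∀ z ∈ Ann, z ≠ 0 := fun z hz => norm_pos_iff.1 (hrin.trans_le hz.1)
  have hsub₀ : Metric.closedBall c₀ R₀ ⊆ Ann := fun w hw => by
    have := hball w hw
    exact ⟨by linarith, by linarith⟩
  have hpd : DifferentiableOn ℂ (fun z : ℂ => qPochInfC (q : ℂ) ((q : ℂ) * (v : ℂ) / z)) Ann := by
    intro z hz
    have h1 : DifferentiableAt ℂ (fun z : ℂ => (q : ℂ) * (v : ℂ) / z) z :=
      (differentiableAt_const _).fun_div differentiableAt_id (hAnn0 z hz)
    exact (DifferentiableAt.comp z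
      (bio_qPoch_differentiable q hq0 hq1 ((q : ℂ) * (v : ℂ) / z)) h1).differentiableWithinAt
  have hpne : ∀ z : ℂ, rC ≤ ‖z‖ → qPochInfC (q : ℂ) ((q : ℂ) * (v : ℂ) / z) ≠ 0 := by
    intro z hz
    apply bio_qPoch_ne q hq0 hq1
    rw [norm_div, norm_mul, Complex.norm_real, Complex.norm_real, Real.norm_eq_abs,
      Real.norm_eq_abs, abs_of_nonneg hq0, abs_of_pos hv0, div_lt_one (by linarith)]
    nlinarith
  have hzp : ∀ n : ℤ, DifferentiableOn ℂ (fun z : ℂ => z ^ n) Ann := fun n z hz =>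
    (differentiableAt_zpow.2 (Or.inl (hAnn0 z hz))).differentiableWithinAt
  have hFne' : ∀ z ∈ Ann, F z ≠ 0 := fun z hz => hFne z hz.1 hz.2
  set a : ℕ → ℂ := fun k => ((ξ k * s k : ℝ) : ℂ) with ha
  set P : ℂ → ℂ := fun z => z ^ ((x : ℤ) - m - 1) * (∏ k ∈ Finset.Icc 2 m, (z - a k)) *
        F z / qPochInfC (q : ℂ) ((q : ℂ) * (v : ℂ) / z) with hPdef
  set H : ℂ → ℂ := fun w => w ^ ((l : ℤ) - x) * qPochInfC (q : ℂ) ((q : ℂ) * (v : ℂ) / w) / F w *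
        (∏ k ∈ Finset.Icc 1 l, (w - a (k + 1))⁻¹) with hHdef
  have hsubC : {z : ℂ | rC ≤ ‖z‖ ∧ ‖z‖ ≤ rout} ⊆ Ann := fun z hz => ⟨by linarith [hz.1], hz.2⟩
  have hP : DifferentiableOn ℂ P {z : ℂ | rC ≤ ‖z‖ ∧ ‖z‖ ≤ rout} := by
    refine DifferentiableOn.fun_div (DifferentiableOn.fun_mul (DifferentiableOn.fun_mul
      ((hzp _).mono hsubC) ?_) (hFdiff.mono hsubC)) (hpd.mono hsubC) (fun z hz => hpne z hz.1)
    exact DifferentiableOn.fun_finsetProd (fun k _ => by fun_prop)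
  have hpoleS : ∀ k ∈ Finset.Icc 1 l, a (k + 1) ∉ Metric.sphere c₀ R₀ := by
    intro k hk h
    have h1 := hpole (k + 1) (by simp at hk ⊢; omega)
    simp only [Metric.mem_ball, Metric.mem_sphere, ha] at h1 h
    linarith
  have hHc : ContinuousOn H (Metric.sphere c₀ R₀) := by
    have hs : Metric.sphere c₀ R₀ ⊆ Ann := Metric.sphere_subset_closedBall.trans hsub₀
    refine ContinuousOn.mul (ContinuousOn.div (ContinuousOn.mul ((hzp _).mono hs).continuousOn
      (hpd.mono hs).continuousOn) (hFdiff.mono hs).continuousOn (fun z hz => hFne' z (hs hz))) ?_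
    exact (bio_prod_cont _ (fun k => a (k + 1)) _ hpoleS).continuousOn
  have hsum := bio_sum P H rC rout hrC hP c₀ R₀ hR₀ b A hCb hA2 (by linarith)
    (fun w hw => hball w (Metric.sphere_subset_closedBall hw)) hHc
  have hpi : (2 * Real.pi * Complex.I : ℂ) ≠ 0 := Complex.two_pi_I_ne_zero
  have hτ : ∀ n : ℤ, (tauFn b c n : ℂ) ≠ 0 := by
    intro n
    unfold tauFn
    split_ifs
    · exact_mod_cast (zpow_pos hb0 n).ne'
    · exact_mod_cast (zpow_pos hc0 n).ne'
  have hphi : ∀ n : ℤ, (∮ w in C(cD, RD),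
      w ^ (-((x : ℤ) + n - l + 1)) *
        (∏ k ∈ Finset.Icc 1 l, (w - ((ξ (k + 1) * s (k + 1) : ℝ) : ℂ))⁻¹) *
        qPochInfC (q : ℂ) ((q : ℂ) * (v : ℂ) / w) / F w)
      = ∮ w in C(c₀, R₀), w ^ (-n - 1) * H w := by
    intro n
    have h1 := bio_indep (fun k => a (k + 1)) cD c₀ RD R₀ hRD hR₀ (Finset.Icc 1 l)
      (fun w => w ^ (-((x : ℤ) + n - l + 1)) * qPochInfC (q : ℂ) ((q : ℂ) * (v : ℂ) / w) / F w)
      (fun k hk => hpole' (k + 1) (by simp at hk ⊢; omega))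
      (fun k hk => hpole (k + 1) (by simp at hk ⊢; omega))
      (((hzp _).fun_mul hpd |>.fun_div hFdiff hFne').mono (Set.union_subset hDann hsub₀))
    refine Eq.trans ?_ (h1.trans ?_)
    · congr 1
      funext w
      ring
    · apply circleIntegral.integral_congr hR₀.le
      intro w hw
      have hw0 : w ≠ 0 := hAnn0 w (hsub₀ (Metric.sphere_subset_closedBall hw))
      have e : (-((x : ℤ) + n - l + 1)) = (-n - 1) + ((l : ℤ) - x) := by ring
      simp only [hHdef]
      rw [e, zpow_add₀ hw0]
      ring
  have hpsi : ∀ n : ℤ, (∮ z in C(0, rC),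
      z ^ (n + (x : ℤ) - m - 1) *
        (∏ k ∈ Finset.Icc 2 m, (z - ((ξ k * s k : ℝ) : ℂ))) *
        F z / qPochInfC (q : ℂ) ((q : ℂ) * (v : ℂ) / z)) = ∮ z in C(0, rC), z ^ n * P z := by
    intro n
    apply circleIntegral.integral_congr hrC.le
    intro z hz
    have hz' : ‖z‖ = rC := by simpa using hz
    have hz0 : z ≠ 0 := norm_pos_iff.1 (by linarith)
    have e : n + (x : ℤ) - m - 1 = n + ((x : ℤ) - m - 1) := by ring
    simp only [hPdef]
    rw [e, zpow_add₀ hz0]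
    ring
  have hterm : ∀ n : ℤ, phiFn q v b c ξ s F cD RD x l n * psiFn q v b c ξ s F rC x m n
      = (a (m + 1) * (2 * Real.pi * Complex.I)⁻¹ * (2 * Real.pi * Complex.I)⁻¹) *
        ((∮ w in C(c₀, R₀), w ^ (-n - 1) * H w) * ∮ z in C(0, rC), z ^ n * P z) := by
    intro n
    unfold phiFn psiFn
    rw [hphi, hpsi]
    have := hτ n
    simp only [ha]
    field_simp
  have hfin := bio_final a l m hl1 hm1 c₀ R₀ hR₀ (fun w hw => hAnn0 w (hsub₀ hw))
    (fun k hk => hpole k (by simp at hk ⊢; omega))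
    (by
      simp only [ha]
      have := hds (m + 1) (hmem _ (by omega) (by omega))
      exact_mod_cast (hd0.trans_le this).ne')
  have hint : (∮ w in C(c₀, R₀), 2 * Real.pi * Complex.I * P w * H w)
      = 2 * Real.pi * Complex.I * ∮ w in C(c₀, R₀), w ^ ((l : ℤ) - m - 1) *
        (∏ k ∈ Finset.Icc 2 m, (w - a k)) * ∏ k ∈ Finset.Icc 1 l, (w - a (k + 1))⁻¹ := by
    rw [← circleIntegral.integral_const_mul]
    apply circleIntegral.integral_congr hR₀.le
    intro w hw
    have hwb := Metric.sphere_subset_closedBall hw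
    have hw0 : w ≠ 0 := hAnn0 w (hsub₀ hwb)
    have hF0 : F w ≠ 0 := hFne' w (hsub₀ hwb)
    have hq0' := hpne w (by linarith [(hball w hwb).1])
    have e : (l : ℤ) - m - 1 = ((x : ℤ) - m - 1) + ((l : ℤ) - x) := by ring
    simp only [hPdef, hHdef]
    rw [e, zpow_add₀ hw0]
    field_simp
  have hs2 : HasSum (fun n : ℤ =>
      phiFn q v b c ξ s F cD RD x l n * psiFn q v b c ξ s F rC x m n)
      (if l = m then 1 else 0) := by
    have h3 := hsum.mul_left
      (a (m + 1) * (2 * Real.pi * Complex.I)⁻¹ * (2 * Real.pi * Complex.I)⁻¹)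
    rw [hint] at h3
    rw [← hfin]
    have e5 : ∀ I : ℂ, a (m + 1) * (2 * Real.pi * Complex.I)⁻¹ * (2 * Real.pi * Complex.I)⁻¹ *
        (2 * Real.pi * Complex.I * I) = a (m + 1) * ((2 * Real.pi * Complex.I)⁻¹ * I) := by
      intro I
      field_simp
    rw [e5] at h3
    exact Eq.subst (motive := fun f => HasSum f _) (funext fun n => (hterm n).symm) h3
  exact ⟨hs2.summable, hs2.tsum_eq⟩
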